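/- Let K = K_1 × ⋯ × K_d be a d-dimensional CGAP, where K_j is a one-dimensional CGAP of rank r_j and volume m_j, with total rank R = r_1 + ⋯ + r_d and volume M = m_1 ⋯ m_d. Then there exists a d-dimensional symmetric generalized arithmetic progression K_0 of rank at most R and volume at most c(r_1,…,r_d,d)·M such that K ⊆ K_0. -/

import Mathlib

/-- `K ∈ 𝒦_{r,m}`: `K` is a one-dimensional CGAP of rank `r` and volume at most `m`. -/
def IsCGAP (r m : ℕ) (K : Set ℝ) : Prop :=
  ∃ (h : Fin r → ℝ) (V : Set (Fin r → ℝ)),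
    (∀ v ∈ V, -v ∈ V) ∧ Convex ℝ V ∧
    {ν : Fin r → ℤ | (fun j => (ν j : ℝ)) ∈ V}.Finite ∧
    Nat.card {ν : Fin r → ℤ | (fun j => (ν j : ℝ)) ∈ V} ≤ m ∧
    K = {x : ℝ | ∃ ν : Fin r → ℤ, (fun j => (ν j : ℝ)) ∈ V ∧ x = ∑ j, (ν j : ℝ) * h j}

/-- The `d`-dimensional symmetric GAP with generators `g : Fin s → ℝ^d` and dimensions `L`:
`{m₁ g₁ + ⋯ + m_s g_s : |m_j| ≤ L j, m_j ∈ ℤ}`. -/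
def symmGAPd {d s : ℕ} (g : Fin s → EuclideanSpace ℝ (Fin d)) (L : Fin s → ℝ) :
    Set (EuclideanSpace ℝ (Fin d)) :=
  {x | ∃ m : Fin s → ℤ, (∀ j, |(m j : ℝ)| ≤ L j) ∧ x = ∑ j, (m j : ℝ) • g j}

/-- The volume of a (symmetric) GAP: the cardinality of the corresponding integer box. -/
noncomputable def symmGAPvol {s : ℕ} (L : Fin s → ℝ) : ℕ :=
  Nat.card {m : Fin s → ℤ | ∀ j, |(m j : ℝ)| ≤ L j}

/-- A norm on an abelian group, homogeneous for multiplication by integers, all of whose balls are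
finite. -/
structure IsLatticeNorm {Γ : Type} [AddCommGroup Γ] (N : Γ → ℝ) : Prop where
  add_le : ∀ x y, N (x + y) ≤ N x + N y
  neg : ∀ x, N (-x) = N x
  nsmul : ∀ (n : ℕ) x, N (n • x) = n * N x
  pos : ∀ x, x ≠ 0 → 0 < N x
  finite_ball : ∀ R, {x | N x ≤ R}.Finite

namespace IsLatticeNorm

variable {Γ : Type} [AddCommGroup Γ] {N : Γ → ℝ}

lemma zero (h : IsLatticeNorm N) : N 0 = 0 := by simpa using h.nsmul 0 0

lemma nonneg (h : IsLatticeNorm N) (x : Γ) : 0 ≤ N x := by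
  rcases eq_or_ne x 0 with rfl | hx
  · exact h.zero.ge
  · exact (h.pos x hx).le

lemma zsmul (h : IsLatticeNorm N) (n : ℤ) (x : Γ) : N (n • x) = |(n : ℝ)| * N x := by
  obtain ⟨k, rfl | rfl⟩ := n.eq_nat_or_neg
  · simp [h.nsmul]
  · simp [h.nsmul, h.neg]

lemma sum_le (h : IsLatticeNorm N) {ι : Type} (s : Finset ι) (f : ι → Γ) :
    N (∑ i ∈ s, f i) ≤ ∑ i ∈ s, N (f i) := by
  classical
  induction s using Finset.induction_on with
  | empty => simp [h.zero]
  | insert a s ha ih =>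
    rw [Finset.sum_insert ha, Finset.sum_insert ha]
    exact (h.add_le _ _).trans (by gcongr)

lemma isTorsionFree (h : IsLatticeNorm N) : Module.IsTorsionFree ℤ Γ := by
  refine Module.IsTorsionFree.of_smul_eq_zero fun n x hnx => ?_
  by_contra! hcon
  have := h.zsmul n x
  rw [hnx, h.zero] at this
  have h1 : 0 < |(n : ℝ)| := by simpa using hcon.1
  exact absurd this (mul_pos h1 (h.pos x hcon.2)).ne

lemma exists_shortest [Nontrivial Γ] (h : IsLatticeNorm N) :
    ∃ b : Γ, b ≠ 0 ∧ ∀ x, x ≠ 0 → N b ≤ N x := by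
  obtain ⟨x₀, hx₀⟩ := exists_ne (0 : Γ)
  have hfin : {x | x ≠ 0 ∧ N x ≤ N x₀}.Finite :=
    (h.finite_ball (N x₀)).subset fun x hx => hx.2
  obtain ⟨b, hb, hmin⟩ := Set.exists_min_image _ N hfin ⟨x₀, hx₀, le_rfl⟩
  refine ⟨b, hb.1, fun x hx => ?_⟩
  rcases le_total (N x) (N x₀) with hle | hle
  · exact hmin x ⟨hx, hle⟩
  · exact hb.2.trans hle

/-- The number of points of a large ball is controlled by the number of points of the unit ball. -/
lemma card_ball_le (h : IsLatticeNorm N) {r : ℕ} (e : Γ ≃+ (Fin r → ℤ)) {R : ℝ} {n : ℕ}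
    (hn : 0 < n) (hR : 2 * R < n) :
    Nat.card {x | N x ≤ R} ≤ n ^ r * Nat.card {x | N x < 1} := by
  classical
  have : NeZero n := ⟨hn.ne'⟩
  have hfin1 : {x | N x < 1}.Finite := (h.finite_ball 1).subset fun x (hx : N x < 1) => hx.le
  have key := Finset.card_le_mul_card_image
    (f := fun x : Γ => fun i => ((e x i : ℤ) : ZMod n)) (h.finite_ball R).toFinset
    (Nat.card {x | N x < 1}) ?_
  · rw [Nat.card_coe_set_eq, Set.ncard_eq_toFinset_card _ (h.finite_ball R), mul_comm]
    refine key.trans (Nat.mul_le_mul_left _ ((Finset.card_le_univ _).trans ?_))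
    simp [ZMod.card]
  · intro c hc
    obtain ⟨x₀, hx₀, rfl⟩ := Finset.mem_image.1 hc
    rw [Nat.card_coe_set_eq, Set.ncard_eq_toFinset_card _ hfin1]
    have hdiv : ∀ x : Γ, (fun i => ((e x i : ℤ) : ZMod n)) = (fun i => ((e x₀ i : ℤ) : ZMod n)) →
        ∃ z : Γ, x = x₀ + n • z := by
      intro x hx
      have : ∀ i, ∃ k : ℤ, e x i - e x₀ i = n * k := by
        intro i
        have hi := congrFun hx i
        exact (ZMod.intCast_eq_intCast_iff_dvd_sub _ _ _).1 hi.symm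
      choose k hk using this
      refine ⟨e.symm k, e.injective ?_⟩
      rw [map_add, map_nsmul, e.apply_symm_apply]
      ext i
      simp [← hk i]
    choose! z hz using hdiv
    refine Finset.card_le_card_of_injOn z ?_ ?_
    · intro x hx
      simp only [Finset.coe_filter, Set.Finite.mem_toFinset, Set.mem_ofPred_eq] at hx hx₀
      have h1 : N (n • z x) ≤ N x + N x₀ := by
        have : n • z x = x + -x₀ := by
          nth_rewrite 2 [hz x hx.2]; abel
        rw [this, ← h.neg x₀]
        exact h.add_le _ _
      rw [h.nsmul] at h1
      have hn' : (0 : ℝ) < n := by exact_mod_cast hn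
      simp only [Set.Finite.coe_toFinset, Set.mem_ofPred_eq]
      nlinarith [hx.1]
    · intro x hx y hy hxy
      simp only [Finset.coe_filter, Set.Finite.mem_toFinset, Set.mem_ofPred_eq] at hx hy
      rw [hz x hx.2, hz y hy.2, hxy]

/-- The norm induced on a quotient: the infimum of `N x / n` over `n > 0` and lifts `x` of
`n • y`. -/
noncomputable def quotientNorm (N : Γ → ℝ) (S : Submodule ℤ Γ) (y : Γ ⧸ S) : ℝ :=
  sInf {t | ∃ n : ℕ, 0 < n ∧ ∃ x, S.mkQ x = n • y ∧ t = N x / n}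

lemma quotientNorm_le (h : IsLatticeNorm N) {S : Submodule ℤ Γ} {y : Γ ⧸ S} {n : ℕ} (hn : 0 < n)
    {x : Γ} (hx : S.mkQ x = n • y) : quotientNorm N S y ≤ N x / n := by
  refine csInf_le ⟨0, ?_⟩ ⟨n, hn, x, hx, rfl⟩
  rintro _ ⟨n, hn, x, -, rfl⟩
  exact div_nonneg (h.nonneg x) n.cast_nonneg

lemma le_quotientNorm {S : Submodule ℤ Γ} {y : Γ ⧸ S} {t : ℝ}
    (ht : ∀ n : ℕ, 0 < n → ∀ x, S.mkQ x = n • y → t ≤ N x / n) : t ≤ quotientNorm N S y := by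
  obtain ⟨x, hx⟩ := S.mkQ_surjective y
  refine le_csInf ⟨_, 1, one_pos, x, by simpa using hx, rfl⟩ ?_
  rintro _ ⟨n, hn, x, hx, rfl⟩
  exact ht n hn x hx

lemma exists_of_quotientNorm_lt {S : Submodule ℤ Γ} {y : Γ ⧸ S} {t : ℝ}
    (ht : quotientNorm N S y < t) : ∃ n : ℕ, 0 < n ∧ ∃ x, S.mkQ x = n • y ∧ N x / n < t := by
  by_contra! hcon
  exact absurd (le_quotientNorm hcon) ht.not_ge

lemma quotientNorm_mkQ_le (h : IsLatticeNorm N) (S : Submodule ℤ Γ) (x : Γ) :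
    quotientNorm N S (S.mkQ x) ≤ N x := by
  simpa using h.quotientNorm_le (S := S) (y := S.mkQ x) one_pos (x := x) (by simp)

lemma quotientNorm_add_le (h : IsLatticeNorm N) (S : Submodule ℤ Γ) (y z : Γ ⧸ S) :
    quotientNorm N S (y + z) ≤ quotientNorm N S y + quotientNorm N S z := by
  refine le_of_forall_pos_le_add fun ε hε => ?_
  obtain ⟨n, hn, x, hx, hxt⟩ := exists_of_quotientNorm_lt
    (lt_add_of_pos_right (quotientNorm N S y) (half_pos hε))
  obtain ⟨m, hm, w, hw, hwt⟩ := exists_of_quotientNorm_lt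
    (lt_add_of_pos_right (quotientNorm N S z) (half_pos hε))
  have hn' : (0 : ℝ) < n := by exact_mod_cast hn
  have hm' : (0 : ℝ) < m := by exact_mod_cast hm
  have h1 : quotientNorm N S (y + z) ≤ N (m • x + n • w) / ((n * m : ℕ) : ℝ) := by
    refine h.quotientNorm_le (Nat.mul_pos hn hm) ?_
    rw [map_add, map_nsmul, map_nsmul, hx, hw, smul_add, smul_smul, smul_smul, mul_comm m n]
  have h2 : N (m • x + n • w) / ((n * m : ℕ) : ℝ) ≤ N x / n + N w / m := by
    have := h.add_le (m • x) (n • w)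
    rw [h.nsmul, h.nsmul] at this
    rw [div_add_div _ _ hn'.ne' hm'.ne']
    push_cast
    gcongr
    linarith
  linarith

lemma quotientNorm_neg_le (h : IsLatticeNorm N) (S : Submodule ℤ Γ) (y : Γ ⧸ S) :
    quotientNorm N S (-y) ≤ quotientNorm N S y := by
  refine le_quotientNorm fun n hn x hx => ?_
  rw [← h.neg x]
  exact h.quotientNorm_le hn (by rw [map_neg, hx, smul_neg])

lemma quotientNorm_neg (h : IsLatticeNorm N) (S : Submodule ℤ Γ) (y : Γ ⧸ S) :
    quotientNorm N S (-y) = quotientNorm N S y :=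
  le_antisymm (h.quotientNorm_neg_le S y) (by simpa using h.quotientNorm_neg_le S (-y))

lemma quotientNorm_nsmul (h : IsLatticeNorm N) (S : Submodule ℤ Γ) (k : ℕ) (y : Γ ⧸ S) :
    quotientNorm N S (k • y) = k * quotientNorm N S y := by
  rcases k.eq_zero_or_pos with rfl | hk
  · simp only [zero_smul, Nat.cast_zero, zero_mul]
    refine le_antisymm ?_ (le_quotientNorm fun n _ x _ => div_nonneg (h.nonneg x) n.cast_nonneg)
    simpa [h.zero] using h.quotientNorm_mkQ_le S 0
  have hk' : (0 : ℝ) < k := by exact_mod_cast hk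
  refine le_antisymm ?_ ?_
  · rw [← div_le_iff₀' hk']
    refine le_quotientNorm fun n hn x hx => ?_
    rw [div_le_iff₀' hk', ← mul_div_assoc, ← h.nsmul]
    refine h.quotientNorm_le hn ?_
    rw [map_nsmul, hx, smul_comm]
  · refine le_quotientNorm fun n hn x hx => ?_
    have hn' : (0 : ℝ) < n := by exact_mod_cast hn
    have := h.quotientNorm_le (y := y) (Nat.mul_pos hn hk) (x := x) (by rw [hx, smul_smul])
    calc k * quotientNorm N S y ≤ k * (N x / ((n * k : ℕ) : ℝ)) := by gcongr
      _ = N x / n := by push_cast; field_simp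

/-- Modulo a shortest vector, every element has a lift of nearly minimal norm. -/
lemma exists_lift (h : IsLatticeNorm N) {b : Γ} (hb : b ≠ 0) {S : Submodule ℤ Γ}
    (hS : S = Submodule.span ℤ {b}) (y : Γ ⧸ S) :
    ∃ x, S.mkQ x = y ∧ N x ≤ quotientNorm N S y + 3 / 4 * N b := by
  have hbpos := h.pos b hb
  obtain ⟨n, hn, x₀, hx₀, hlt⟩ := exists_of_quotientNorm_lt
    (show quotientNorm N S y < quotientNorm N S y + N b / 4 by linarith)
  obtain ⟨x₁, hx₁⟩ := S.mkQ_surjective y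
  have hmem : n • x₁ - x₀ ∈ S := by
    rw [← S.ker_mkQ, LinearMap.mem_ker, map_sub, map_nsmul, hx₁, hx₀, sub_self]
  obtain ⟨j, hj⟩ := Submodule.mem_span_singleton.1 (hS ▸ hmem)
  have hn' : (0 : ℝ) < n := by exact_mod_cast hn
  set q : ℤ := round ((j : ℝ) / n)
  have hq : |((j - n * q : ℤ) : ℝ)| ≤ n / 2 := by
    have := abs_sub_round ((j : ℝ) / n)
    have h2 : ((j - n * q : ℤ) : ℝ) = n * ((j : ℝ) / n - q) := by
      push_cast; field_simp
    rw [h2, abs_mul, abs_of_pos hn']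
    nlinarith
  refine ⟨x₁ - q • b, ?_, ?_⟩
  · have : S.mkQ b = 0 := by
      simp [hS]
    rw [map_sub, map_zsmul, this, smul_zero, sub_zero, hx₁]
  · have heq : n • (x₁ - q • b) = x₀ + (j - n * q) • b := by
      rw [sub_smul, hj, smul_sub, mul_smul, natCast_zsmul]
      abel
    have h1 := h.add_le x₀ ((j - n * q) • b)
    rw [← heq, h.nsmul, h.zsmul] at h1
    rw [div_lt_iff₀ hn'] at hlt
    have h2 : |((j - n * q : ℤ) : ℝ)| * N b ≤ n / 2 * N b := by gcongr
    refine le_of_mul_le_mul_left ?_ hn'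
    linarith

lemma quarter_le_quotientNorm (h : IsLatticeNorm N) {b : Γ} (hb : b ≠ 0)
    (hmin : ∀ x, x ≠ 0 → N b ≤ N x) {S : Submodule ℤ Γ} (hS : S = Submodule.span ℤ {b})
    {y : Γ ⧸ S} (hy : y ≠ 0) : N b / 4 ≤ quotientNorm N S y := by
  obtain ⟨x, hx, hN⟩ := h.exists_lift hb hS y
  have := hmin x (by rintro rfl; exact hy (by rw [← hx, map_zero]))
  linarith

lemma quotient (h : IsLatticeNorm N) {b : Γ} (hb : b ≠ 0) (hmin : ∀ x, x ≠ 0 → N b ≤ N x)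
    {S : Submodule ℤ Γ} (hS : S = Submodule.span ℤ {b}) : IsLatticeNorm (quotientNorm N S) where
  add_le := h.quotientNorm_add_le _
  neg := h.quotientNorm_neg _
  nsmul := h.quotientNorm_nsmul _
  pos y hy := by
    have := h.quarter_le_quotientNorm hb hmin hS hy
    linarith [h.pos b hb]
  finite_ball R := by
    refine ((h.finite_ball (R + 3 / 4 * N b)).image S.mkQ).subset ?_
    intro y hy
    obtain ⟨x, hx, hN⟩ := h.exists_lift hb hS y
    have hy' : quotientNorm N S y ≤ R := hy
    exact ⟨x, show N x ≤ _ by linarith, hx⟩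

lemma finrank_quotient_span_singleton [Module.Finite ℤ Γ] (h : IsLatticeNorm N) {b : Γ}
    (hb : b ≠ 0) {S : Submodule ℤ Γ} (hS : S = Submodule.span ℤ {b}) :
    Module.finrank ℤ (Γ ⧸ S) + 1 = Module.finrank ℤ Γ := by
  have := h.isTorsionFree
  rw [← Submodule.finrank_quotient_add_finrank S]
  congr 1
  rw [hS, ← (LinearEquiv.toSpanNonzeroSingleton ℤ Γ b hb).finrank_eq, Module.finrank_self]

end IsLatticeNorm

/-- Existence of reduced bases: coordinates with respect to a suitable generating family are
controlled by the norm. -/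
lemma exists_reduced_basis (k : ℕ) : ∃ C : ℝ, 0 < C ∧
    ∀ (Γ : Type) [AddCommGroup Γ] [Module.Finite ℤ Γ] (N : Γ → ℝ), IsLatticeNorm N →
      Module.finrank ℤ Γ = k →
      ∃ w : Fin k → Γ, (∀ i, w i ≠ 0) ∧ (∀ x, ∃ m : Fin k → ℤ, x = ∑ i, m i • w i) ∧
        ∀ (m : Fin k → ℤ) i, |(m i : ℝ)| * N (w i) ≤ C * N (∑ i, m i • w i) := by
  induction k with
  | zero =>
    refine ⟨1, one_pos, fun Γ _ _ N h hk => ⟨Fin.elim0, fun i => i.elim0, fun x => ?_,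
      fun _ i => i.elim0⟩⟩
    have := h.isTorsionFree
    have : Subsingleton Γ := Module.finrank_zero_iff.1 hk
    exact ⟨Fin.elim0, Subsingleton.elim _ _⟩
  | succ k ih =>
    obtain ⟨C, hC, ih⟩ := ih
    refine ⟨1 + (k + 1) * (4 * C), by positivity, fun Γ _ _ N h hk => ?_⟩
    have := h.isTorsionFree
    have : Nontrivial Γ := Module.nontrivial_of_finrank_pos (R := ℤ) (by omega)
    obtain ⟨b, hb, hmin⟩ := h.exists_shortest
    obtain ⟨S, hS⟩ : ∃ S : Submodule ℤ Γ, S = Submodule.span ℤ {b} := ⟨_, rfl⟩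
    have hbS : S.mkQ b = 0 := by
      simp [hS]
    have hfr := h.finrank_quotient_span_singleton hb hS
    obtain ⟨w', hw'0, hw'span, hw'⟩ := ih (Γ ⧸ S) _ (h.quotient hb hmin hS) (by omega)
    choose w hwlift hwN using fun i => h.exists_lift hb hS (w' i)
    have hw4 : ∀ i, N (w i) ≤ 4 * IsLatticeNorm.quotientNorm N S (w' i) := fun i => by
      have h1 := h.quarter_le_quotientNorm hb hmin hS (hw'0 i)
      have h2 := hwN i
      linarith
    refine ⟨Fin.cons b w, ?_, ?_, ?_⟩
    · refine Fin.cases (by simpa using hb) fun i => ?_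
      rw [Fin.cons_succ]
      intro h0
      apply hw'0 i
      rw [← hwlift i, h0, map_zero]
    · intro x
      obtain ⟨m, hm⟩ := hw'span (S.mkQ x)
      have hmem : x - ∑ i, m i • w i ∈ S := by
        rw [← S.ker_mkQ, LinearMap.mem_ker, map_sub, map_sum, hm, sub_eq_zero]
        exact Finset.sum_congr rfl fun i _ => by rw [map_zsmul, hwlift]
      obtain ⟨j, hj⟩ := Submodule.mem_span_singleton.1 (hS ▸ hmem)
      refine ⟨Fin.cons j m, ?_⟩
      simp [Fin.sum_univ_succ, hj]
    · intro m
      set x := ∑ i, m i • (Fin.cons b w : Fin (k + 1) → Γ) i with hx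
      have hxs : x = m 0 • b + ∑ i : Fin k, m i.succ • w i := by
        rw [hx, Fin.sum_univ_succ]; simp
      have hpi : S.mkQ x = ∑ i : Fin k, m i.succ • w' i := by
        rw [hxs, map_add, map_zsmul, hbS, smul_zero, zero_add, map_sum]
        exact Finset.sum_congr rfl fun i _ => by rw [map_zsmul, hwlift]
      have htail : ∀ i : Fin k, |(m i.succ : ℝ)| * N (w i) ≤ 4 * C * N x := by
        intro i
        have h1 := hw' (fun i => m i.succ) i
        rw [← hpi] at h1
        have h2 := h.quotientNorm_mkQ_le S x
        calc |(m i.succ : ℝ)| * N (w i)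
            ≤ |(m i.succ : ℝ)| * (4 * IsLatticeNorm.quotientNorm N S (w' i)) := by
              gcongr; exact hw4 i
          _ = 4 * (|(m i.succ : ℝ)| * IsLatticeNorm.quotientNorm N S (w' i)) := by ring
          _ ≤ 4 * (C * N x) := by
              refine mul_le_mul_of_nonneg_left (h1.trans ?_) (by norm_num)
              gcongr
          _ = 4 * C * N x := by ring
      have hNx := h.nonneg x
      have hCN : 0 ≤ C * N x := by positivity
      refine Fin.cases ?_ fun i => ?_
      · rw [Fin.cons_zero, ← h.zsmul]
        have h1 : m 0 • b = x + -∑ i : Fin k, m i.succ • w i := by rw [hxs]; abel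
        have h2 : N (∑ i : Fin k, m i.succ • w i) ≤ k * (4 * C * N x) := by
          refine (h.sum_le _ _).trans ?_
          calc ∑ i : Fin k, N (m i.succ • w i) ≤ ∑ _i : Fin k, 4 * C * N x :=
                Finset.sum_le_sum fun i _ => by rw [h.zsmul]; exact htail i
            _ = k * (4 * C * N x) := by simp
        rw [h1]
        have h3 := h.add_le x (-∑ i : Fin k, m i.succ • w i)
        rw [h.neg] at h3
        linarith
      · rw [Fin.cons_succ]
        have h4 : 0 ≤ (k : ℝ) * (C * N x) := by positivity
        linarith [htail i]

lemma isClosedEmbedding_intCast_pi (r : ℕ) :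
    Topology.IsClosedEmbedding (fun (ν : Fin r → ℤ) (j : Fin r) => (ν j : ℝ)) :=
  Topology.IsClosedEmbedding.piMap fun _ => Int.isClosedEmbedding_coe_real

/-- A symmetric convex set with finitely many integer points has the same integer points as the
open unit ball of a norm. -/
lemma exists_latticeNorm {r : ℕ} {V : Set (Fin r → ℝ)} (hsymm : ∀ v ∈ V, -v ∈ V)
    (hconv : Convex ℝ V) (hne : V.Nonempty)
    (hfin : {ν : Fin r → ℤ | (fun j => (ν j : ℝ)) ∈ V}.Finite) :
    ∃ N : (Fin r → ℤ) → ℝ, IsLatticeNorm N ∧ ∀ ν, N ν < 1 ↔ (fun j => (ν j : ℝ)) ∈ V := by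
  set ι : (Fin r → ℤ) → Fin r → ℝ := fun ν j => (ν j : ℝ) with hι
  have hemb : Topology.IsClosedEmbedding ι := isClosedEmbedding_intCast_pi r
  set P : Set (Fin r → ℤ) := {ν | ι ν ∈ V}
  have hι0 : ι 0 = 0 := by ext; simp [hι]
  have h0V : (0 : Fin r → ℝ) ∈ V := by
    obtain ⟨v, hv⟩ := hne
    simpa using hconv.midpoint_mem hv (hsymm v hv)
  have h0P : (0 : Fin r → ℤ) ∈ P := by simpa [P, hι0] using h0V
  set K := convexHull ℝ (ι '' P)
  have hKV : K ⊆ V := convexHull_min (by rintro _ ⟨ν, hν, rfl⟩; exact hν) hconv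
  have hKc : IsCompact K := (hfin.image ι).isCompact_convexHull ℝ
  have hUo : IsOpen (ι '' Pᶜ)ᶜ := (hemb.isClosedMap _ (isClosed_discrete _)).isOpen_compl
  have hKU : K ⊆ (ι '' Pᶜ)ᶜ := by
    rintro _ hx ⟨ν, hν, rfl⟩
    exact hν (hKV hx)
  obtain ⟨δ, hδ, hsub⟩ := hKc.exists_thickening_subset_open hUo hKU
  set W := Metric.thickening δ K
  have hWo : IsOpen W := Metric.isOpen_thickening
  have hWc : Convex ℝ W := (convex_convexHull ℝ _).thickening δ
  have hKW : K ⊆ W := Metric.self_subset_thickening hδ K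
  have h0W : (0 : Fin r → ℝ) ∈ W := hKW (subset_convexHull ℝ _ ⟨0, h0P, hι0⟩)
  have hKneg : ∀ x ∈ K, -x ∈ K := by
    have himg : -(ι '' P) = ι '' P := by
      have hsub : ∀ y ∈ ι '' P, -y ∈ ι '' P := by
        rintro _ ⟨ν, hν, rfl⟩
        have hνn : ι (-ν) = -ι ν := by ext; simp [hι]
        exact ⟨-ν, by simpa [P, hνn] using hsymm _ hν, hνn⟩
      ext y
      exact ⟨fun hy => by simpa using hsub _ hy, fun hy => hsub y hy⟩
    intro x hx
    have : -x ∈ -K := by simpa using hx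
    rwa [← convexHull_neg, himg] at this
  have hWneg : ∀ x ∈ W, -x ∈ W := by
    intro x hx
    obtain ⟨z, hz, hd⟩ := Metric.mem_thickening_iff.1 hx
    exact Metric.mem_thickening_iff.2 ⟨-z, hKneg z hz, by rwa [dist_neg_neg]⟩
  have hWabs : Absorbent ℝ W := absorbent_nhds_zero (hWo.mem_nhds h0W)
  obtain ⟨ρ, hρ, hWρ⟩ := hKc.isBounded.thickening.subset_closedBall_lt 0 0
  have hlow : ∀ x, ‖x‖ / ρ ≤ gauge W x := fun x => le_gauge_of_subset_closedBall hWabs hρ.le hWρ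
  refine ⟨fun ν => gauge W (ι ν), ⟨fun x y => ?_, fun x => ?_, fun n x => ?_, fun x hx => ?_,
    fun R => ?_⟩, fun ν => ?_⟩
  · have : ι (x + y) = ι x + ι y := by ext; simp [hι]
    rw [this]
    exact gauge_add_le hWc hWabs _ _
  · have : ι (-x) = -ι x := by ext; simp [hι]
    rw [this]
    exact gauge_neg hWneg _
  · have : ι (n • x) = (n : ℝ) • ι x := by ext; simp [hι]
    rw [this, gauge_smul_of_nonneg n.cast_nonneg, smul_eq_mul]
  · have : ι x ≠ 0 := fun h => hx (hemb.injective (h.trans hι0.symm))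
    exact (div_pos (norm_pos_iff.2 this) hρ).trans_le (hlow _)
  · have hc := hemb.isCompact_preimage (isCompact_closedBall (0 : Fin r → ℝ) (R * ρ))
    refine hc.finite_of_discrete.subset fun x hx => ?_
    have := (hlow (ι x)).trans hx
    rw [div_le_iff₀ hρ] at this
    simpa using this
  · have hmem : gauge W (ι ν) < 1 ↔ ι ν ∈ W :=
      Set.ext_iff.1 (setOfPred_gauge_lt_one_eq_self_of_isOpen hWc h0W hWo) _
    rw [hmem]
    refine ⟨fun h => ?_, fun h => hKW (subset_convexHull ℝ _ ⟨ν, h, rfl⟩)⟩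
    by_contra hν
    exact hsub h ⟨ν, hν, rfl⟩

/-- A one-dimensional CGAP is contained in a symmetric GAP of the same rank and comparable
volume. -/
lemma exists_symmGAP_of_isCGAP (r : ℕ) : ∃ C : ℝ, 0 < C ∧
    ∀ m : ℕ, 0 < m → ∀ K : Set ℝ, IsCGAP r m K →
      ∃ a L : Fin r → ℝ,
        (∀ x ∈ K, ∃ n : Fin r → ℤ, (∀ i, |(n i : ℝ)| ≤ L i) ∧ x = ∑ i, (n i : ℝ) * a i) ∧
        (symmGAPvol L : ℝ) ≤ C * m := by
  obtain ⟨C, hC, hred⟩ := exists_reduced_basis r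
  obtain ⟨n, hn⟩ := exists_nat_gt (2 * (r * C))
  have hn0 : 0 < n := by
    have : (0 : ℝ) < n := lt_of_le_of_lt (by positivity) hn
    exact_mod_cast this
  refine ⟨(n : ℝ) ^ r, by positivity, ?_⟩
  rintro m hm _ ⟨h, V, hsymm, hconv, hfin, hcard, rfl⟩
  rcases V.eq_empty_or_nonempty with rfl | hne
  · refine ⟨0, 0, by simp, ?_⟩
    have h1 : symmGAPvol (0 : Fin r → ℝ) = 1 := by
      have : {k : Fin r → ℤ | ∀ j, |(k j : ℝ)| ≤ (0 : Fin r → ℝ) j} = {0} := by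
        ext k; simp [funext_iff]
      rw [symmGAPvol, this]; simp
    rw [h1]
    have h2 : 1 ≤ n ^ r * m := Nat.mul_pos (pow_pos hn0 r) hm
    exact_mod_cast h2
  obtain ⟨N, hN, hNV⟩ := exists_latticeNorm hsymm hconv hne hfin
  obtain ⟨w, hw0, hspan, hw⟩ := hred (Fin r → ℤ) N hN (by simp)
  have hwpos : ∀ i, 0 < N (w i) := fun i => hN.pos _ (hw0 i)
  refine ⟨fun i => ∑ j, (w i j : ℝ) * h j, fun i => C / N (w i), ?_, ?_⟩
  · rintro _ ⟨ν, hν, rfl⟩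
    obtain ⟨k, hk⟩ := hspan ν
    refine ⟨k, fun i => ?_, ?_⟩
    · rw [le_div_iff₀ (hwpos i)]
      have h1 := hw k i
      rw [← hk] at h1
      have h2 := (hNV ν).2 hν
      nlinarith
    · have hνj : ∀ j, (ν j : ℝ) = ∑ i, (k i : ℝ) * w i j := fun j => by
        rw [hk]; simp
      simp_rw [hνj, Finset.sum_mul, Finset.mul_sum]
      rw [Finset.sum_comm]
      simp_rw [mul_assoc]
  · have h1 : symmGAPvol (fun i => C / N (w i)) ≤ Nat.card {x | N x ≤ r * C} := by
      have : Finite {x | N x ≤ r * C} := hN.finite_ball _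
      refine Nat.card_le_card_of_injective
        (fun k => ⟨∑ i, k.1 i • w i, ?_⟩) ?_
      · show N _ ≤ r * C
        refine (hN.sum_le _ _).trans ?_
        calc ∑ i, N (k.1 i • w i) ≤ ∑ _i : Fin r, C := Finset.sum_le_sum fun i _ => by
              rw [hN.zsmul, ← le_div_iff₀ (hwpos i)]
              exact k.2 i
          _ = r * C := by simp
      · intro k l hkl
        have hsum : ∑ i, (k.1 - l.1) i • w i = 0 := by
          simp only [Pi.sub_apply, sub_smul, Finset.sum_sub_distrib]
          exact sub_eq_zero.2 (Subtype.ext_iff.1 hkl)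
        ext i
        have h2 := hw (k.1 - l.1) i
        rw [hsum, hN.zero, mul_zero] at h2
        have h3 : |(((k.1 - l.1) i : ℤ) : ℝ)| ≤ 0 := by
          by_contra! hcon
          exact absurd h2 (mul_pos hcon (hwpos i)).not_ge
        have h4 : (k.1 - l.1) i = 0 := by exact_mod_cast abs_nonpos_iff.1 h3
        simpa [sub_eq_zero] using h4
    have h2 := hN.card_ball_le (AddEquiv.refl _) hn0 hn
    have h3 : {x | N x < 1} = {ν : Fin r → ℤ | (fun j => (ν j : ℝ)) ∈ V} := by
      ext ν; exact hNV ν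
    rw [h3] at h2
    have h4 : symmGAPvol (fun i => C / N (w i)) ≤ n ^ r * m :=
      (h1.trans h2).trans (Nat.mul_le_mul_left _ hcard)
    exact_mod_cast h4

/-- The volume of a box over a disjoint union of index sets is the product of the volumes. -/
lemma symmGAPvol_sigma {d : ℕ} {r : Fin d → ℕ} (L : ∀ j, Fin (r j) → ℝ) :
    symmGAPvol (fun i => L (finSigmaFinEquiv.symm i).1 (finSigmaFinEquiv.symm i).2) =
      ∏ j, symmGAPvol (L j) := by
  simp only [symmGAPvol]
  rw [← Nat.card_pi]
  refine Nat.card_congr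
    { toFun := fun k j => ⟨fun i => k.1 (finSigmaFinEquiv ⟨j, i⟩), fun i => ?_⟩
      invFun := fun k => ⟨fun i => (k (finSigmaFinEquiv.symm i).1).1 (finSigmaFinEquiv.symm i).2,
        fun i => (k _).2 _⟩
      left_inv := fun k => ?_
      right_inv := fun k => ?_ }
  · have := k.2 (finSigmaFinEquiv ⟨j, i⟩)
    rwa [Equiv.symm_apply_apply] at this
  · ext i
    simp
  · have hk : ∀ p : (j : Fin d) × Fin (r j),
        (k (finSigmaFinEquiv.symm (finSigmaFinEquiv p)).1).1
          (finSigmaFinEquiv.symm (finSigmaFinEquiv p)).2 = (k p.1).1 p.2 := fun p => by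
      rw [Equiv.symm_apply_apply]
    ext j i
    exact hk ⟨j, i⟩

theorem stmt14 (d : ℕ) (hd : 0 < d) (r : Fin d → ℕ) (hr : ∀ j, 0 < r j) :
    -- the constant depends only on `r₁, …, r_d` and `d`
    ∃ C : ℝ, 0 < C ∧
      ∀ (m : Fin d → ℕ), (∀ j, 0 < m j) →
      ∀ Kj : Fin d → Set ℝ, (∀ j, IsCGAP (r j) (m j) (Kj j)) →
      ∃ (s : ℕ) (g : Fin s → EuclideanSpace ℝ (Fin d)) (L : Fin s → ℝ),
        s ≤ ∑ j, r j ∧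
        {x : EuclideanSpace ℝ (Fin d) | ∀ j, x j ∈ Kj j} ⊆ symmGAPd g L ∧
        (symmGAPvol L : ℝ) ≤ C * ∏ j, (m j : ℝ) := by
  choose C hC hK using fun j => exists_symmGAP_of_isCGAP (r j)
  refine ⟨∏ j, C j, Finset.prod_pos fun j _ => hC j, fun m hm Kj hKj => ?_⟩
  choose a L hsub hvol using fun j => hK j (m j) (hm j) (Kj j) (hKj j)
  refine ⟨∑ j, r j, fun i => EuclideanSpace.single (finSigmaFinEquiv.symm i).1
      (a (finSigmaFinEquiv.symm i).1 (finSigmaFinEquiv.symm i).2),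
    fun i => L (finSigmaFinEquiv.symm i).1 (finSigmaFinEquiv.symm i).2, le_rfl, ?_, ?_⟩
  · intro x hx
    choose n hn hxn using fun j => hsub j (x j) (hx j)
    refine ⟨fun i => n (finSigmaFinEquiv.symm i).1 (finSigmaFinEquiv.symm i).2,
      fun i => hn _ _, ?_⟩
    rw [Equiv.sum_comp finSigmaFinEquiv.symm (fun p : (j : Fin d) × Fin (r j) =>
      (n p.1 p.2 : ℝ) • EuclideanSpace.single p.1 (a p.1 p.2)), Fintype.sum_sigma]
    ext j
    simp [hxn j, Finset.sum_apply, Pi.single_apply]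
  · rw [symmGAPvol_sigma, Nat.cast_prod, ← Finset.prod_mul_distrib]
    exact Finset.prod_le_prod (fun j _ => Nat.cast_nonneg _) fun j _ => hvol j
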